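/- arXiv:1302.2720 — 7 statements merged into one kernel-verified Lean document; each statement's English description precedes it below -/
import Mathlib

section
/- Suppose Q = ⊕_{i∈ℤ} Q_i is a ℤ-grading of the ring Q extending that of P. Let 𝔮 be a prime ideal of Q and set 𝔭 = 𝔮 ∩ P. Then 𝔭 is a homogeneous ideal of P if and only if 𝔮 is a homogeneous ideal of Q. -/
set_option maxHeartbeats 1000000
set_option synthInstance.maxHeartbeats 1000000

open DirectSum in
/-- A graded ring homomorphism commutes with taking homogeneous components. -/
theorem coe_decompose_map_of_forall_mem {ι P Q : Type*} [DecidableEq ι] [AddMonoid ι]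
    [CommRing P] [CommRing Q] (f : P →+* Q)
    (𝒜 : ι → AddSubgroup P) [GradedRing 𝒜] (ℬ : ι → AddSubgroup Q) [GradedRing ℬ]
    (hf : ∀ i, ∀ x ∈ 𝒜 i, f x ∈ ℬ i) (x : P) (i : ι) :
    (decompose ℬ (f x) i : Q) = f (decompose 𝒜 x i) := by
  induction x using Decomposition.inductionOn 𝒜 with
  | zero => simp
  | @homogeneous j m =>
    rw [decompose_coe, decompose_of_mem ℬ (hf j m m.2)]
    by_cases h : j = i
    · subst h
      simp
    · simp [of_eq_of_ne _ _ _ (Ne.symm h)]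
  | add a b ha hb => simp [ha, hb]

/-- Let `P` be a `ℤ`-graded integral domain and `Q` an integral domain containing `P`
(via an injective ring homomorphism `f`) and integral over `P`, and let `Q = ⊕ Q_i` be a
`ℤ`-grading of `Q` extending that of `P`.  Let `𝔮` be a prime ideal of `Q` and
`𝔭 = 𝔮 ∩ P`.  Then `𝔭` is a homogeneous ideal of `P` if and only if `𝔮` is a homogeneous
ideal of `Q`. -/
theorem stmt_13 {P Q : Type*} [CommRing P] [IsDomain P] [CommRing Q] [IsDomain Q]
    (f : P →+* Q) (hinj : Function.Injective f) (hint : f.IsIntegral)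
    (PGr : ℤ → AddSubgroup P) [GradedRing PGr]
    (QGr : ℤ → AddSubgroup Q) [GradedRing QGr]
    (h1 : ∀ i : ℤ, (QGr i).comap f.toAddMonoidHom = PGr i)
    (𝔮 : Ideal Q) (h𝔮 : 𝔮.IsPrime) :
    Ideal.IsHomogeneous PGr (𝔮.comap f) ↔ Ideal.IsHomogeneous QGr 𝔮 := by
  have hf : ∀ i, ∀ x ∈ PGr i, f x ∈ QGr i := fun i x hx ↦ by
    rw [← h1 i] at hx
    exact hx
  have hcomp := coe_decompose_map_of_forall_mem f PGr QGr hf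
  refine ⟨fun h ↦ ?_, fun h i x hx ↦ ?_⟩
  · have := h𝔮.homogeneousCore (𝒜 := QGr)
    rw [Ideal.IsHomogeneous.iff_eq]
    refine le_antisymm (Ideal.toIdeal_homogeneousCore_le QGr 𝔮) fun y hy ↦ ?_
    by_contra hy'
    algebraize [f]
    have hlt := Ideal.comap_lt_comap_of_integral_mem_sdiff
      (Ideal.toIdeal_homogeneousCore_le QGr 𝔮) ⟨hy, hy'⟩ (hint y)
    refine hlt.not_ge fun x hx ↦ ?_
    change f x ∈ (𝔮.homogeneousCore QGr).toIdeal
    classical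
    rw [← DirectSum.sum_support_decompose QGr (f x)]
    refine Ideal.sum_mem _ fun i _ ↦ Ideal.mem_homogeneousCore_of_homogeneous_of_mem
      ⟨i, SetLike.coe_mem _⟩ ?_
    rw [hcomp]
    exact h i hx
  · rw [Ideal.mem_comap, ← hcomp]
    exact h i hx
end

section
/- Suppose Q = ⊕_{i∈ℤ} Q_i is a ℤ-grading of the ring Q extending that of P, and suppose there is a finite group G acting on Q by ring automorphisms with P = Q^G. Let 𝔮 be a prime ideal of Q and let 𝔮̃ = ⊕_{i∈ℤ} (𝔮 ∩ Q_i) be the largest homogeneous ideal of Q contained in 𝔮. Let D_𝔮 = {g ∈ G | g(𝔮) = 𝔮} and I_𝔮 = {g ∈ G | ∀ x ∈ Q, g(x) ≡ x mod 𝔮} be the decomposition and inertia groups of 𝔮, and define D_𝔮̃, I_𝔮̃ similarly for 𝔮̃. Then D_𝔮 ⊆ D_𝔮̃ and I_𝔮 = I_𝔮̃. -/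
set_option maxHeartbeats 1000000
set_option synthInstance.maxHeartbeats 1000000

open DirectSum in
/-- With respect to the order on degrees twisted by `s`, the components of `x` of degree beyond `k`
vanish and its component of degree `k` is `t`. -/
def HasTop {Q : Type*} [CommRing Q] (A : ℤ → AddSubgroup Q) [GradedRing A]
    (s : ℤ) (x : Q) (k : ℤ) (t : Q) : Prop :=
  (decompose A x k : Q) = t ∧ ∀ j : ℤ, s * k < s * j → (decompose A x j : Q) = 0

section

open DirectSum

variable {Q : Type*} [CommRing Q] {A : ℤ → AddSubgroup Q} [GradedRing A]

theorem hasTop_of_mem (s : ℤ) {x : Q} {k : ℤ} (hx : x ∈ A k) : HasTop A s x k x := by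
  refine ⟨decompose_of_mem_same A hx, fun j hj => decompose_of_mem_ne A hx ?_⟩
  rintro rfl
  exact lt_irrefl _ hj

theorem HasTop.mul {s : ℤ} (hs : s ≠ 0) {x y t u : Q} {k l : ℤ}
    (hx : HasTop A s x k t) (hy : HasTop A s y l u) : HasTop A s (x * y) (k + l) (t * u) := by
  classical
  have key : ∀ a b : ℤ, s * (k + l) ≤ s * (a + b) → (a, b) ≠ (k, l) →
      (decompose A x a : Q) * (decompose A y b : Q) = 0 := by
    intro a b hab hne
    by_cases h1 : s * k < s * a
    · rw [hx.2 a h1, zero_mul]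
    by_cases h2 : s * l < s * b
    · rw [hy.2 b h2, mul_zero]
    refine absurd ?_ hne
    rw [mul_add, mul_add] at hab
    have ha : s * a = s * k := by linarith
    have hb : s * b = s * l := by linarith
    rw [mul_left_cancel₀ hs ha, mul_left_cancel₀ hs hb]
  constructor
  · rw [decompose_mul, coe_mul_apply, Finset.sum_eq_single (k, l)]
    · rw [hx.1, hy.1]
    · rintro ⟨a, b⟩ hab hne
      exact key a b (by rw [(Finset.mem_filter.1 hab).2]) hne
    · intro h
      by_contra h0
      refine h (Finset.mem_filter.2 ⟨Finset.mem_product.2 ⟨?_, ?_⟩, rfl⟩)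
      · rw [DFinsupp.mem_support_iff]
        intro hz
        exact h0 (by simp [hz])
      · rw [DFinsupp.mem_support_iff]
        intro hz
        exact h0 (by simp [hz])
  · intro j hj
    rw [decompose_mul, coe_mul_apply]
    refine Finset.sum_eq_zero ?_
    rintro ⟨a, b⟩ hab
    have hj' : a + b = j := (Finset.mem_filter.1 hab).2
    refine key a b (by rw [hj']; exact hj.le) ?_
    intro h
    rw [Prod.mk.injEq] at h
    rw [← hj', h.1, h.2] at hj
    exact lt_irrefl _ hj

theorem HasTop.pow {s : ℤ} (hs : s ≠ 0) {x t : Q} {k : ℤ} (hx : HasTop A s x k t) (n : ℕ) :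
    HasTop A s (x ^ n) (n * k) (t ^ n) := by
  induction n with
  | zero => simpa using hasTop_of_mem s (SetLike.GradedOne.one_mem (A := A))
  | succ n ih =>
    rw [pow_succ, pow_succ, show ((n + 1 : ℕ) : ℤ) * k = n * k + k by push_cast; ring]
    exact ih.mul hs hx

/-- A root of a monic polynomial whose coefficients make it homogeneous, with the variable in
degree `i`, is homogeneous of degree `i`. -/
theorem mem_of_homogeneous_monic_relation [IsDomain Q] {n : ℕ} {c : ℕ → Q} {i : ℤ}
    (hc : ∀ q < n, c q ∈ A ((n - q : ℤ) * i)) {b : Q}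
    (hb : b ^ n + ∑ q ∈ Finset.range n, c q * b ^ q = 0) : b ∈ A i := by
  classical
  have main : ∀ j : ℤ, j ≠ i → (decompose A b j : Q) = 0 := by
    intro j hji
    by_contra hj
    obtain ⟨s, hs, hsj⟩ : ∃ s : ℤ, s ≠ 0 ∧ s * i < s * j := by
      rcases lt_or_gt_of_ne hji with h | h
      · exact ⟨-1, by norm_num, by linarith⟩
      · exact ⟨1, by norm_num, by linarith⟩
    have hjs : j ∈ (decompose A b).support := by
      rw [DFinsupp.mem_support_iff]
      intro hz
      exact hj (by simp [hz])
    obtain ⟨m, hm, hmax⟩ := (decompose A b).support.exists_max_image (fun j => s * j) ⟨j, hjs⟩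
    have hm0 : (decompose A b m : Q) ≠ 0 := by
      rw [DFinsupp.mem_support_iff] at hm
      simpa using hm
    have him : s * i < s * m := hsj.trans_le (hmax j hjs)
    have htop : HasTop A s b m (decompose A b m : Q) := by
      refine ⟨rfl, fun l hl => ?_⟩
      by_contra hl0
      refine not_le.2 hl (hmax l ?_)
      rw [DFinsupp.mem_support_iff]
      intro hz
      exact hl0 (by simp [hz])
    have h0 := congrArg (GradedRing.proj A (n * m)) hb
    simp only [map_add, map_sum, map_zero, GradedRing.proj_apply, (htop.pow hs n).1] at h0
    rw [Finset.sum_eq_zero, add_zero] at h0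
    · exact hm0 (eq_zero_of_pow_eq_zero h0)
    · intro q hq
      have hqn := Finset.mem_range.1 hq
      refine ((hasTop_of_mem s (hc q hqn)).mul hs (htop.pow hs q)).2 _ ?_
      have : (q : ℤ) < n := by exact_mod_cast hqn
      nlinarith
  rw [← sum_support_decompose A b]
  refine sum_mem fun j _ => ?_
  by_cases hji : j = i
  · exact hji ▸ (decompose A b j).2
  · rw [main j hji]
    exact zero_mem _

/-- A homogeneous element integral over a graded subring satisfies a monic relation with
homogeneous coefficients of the appropriate degrees. -/
theorem exists_homogeneous_monic_relation {P : Subring Q}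
    (hP : ∀ x ∈ P, ∀ i : ℤ, (decompose A x i : Q) ∈ P) {i : ℤ} {a : Q} (ha : a ∈ A i)
    {p : Polynomial Q} (hp : p.Monic) (hpP : ∀ n : ℕ, p.coeff n ∈ P) (h0 : p.eval a = 0) :
    ∃ (n : ℕ) (c : ℕ → Q), (∀ q, c q ∈ P) ∧ (∀ q < n, c q ∈ A ((n - q : ℤ) * i)) ∧
      a ^ n + ∑ q ∈ Finset.range n, c q * a ^ q = 0 := by
  set n := p.natDegree with hn
  refine ⟨n, fun q => (decompose A (p.coeff q) ((n - q : ℤ) * i) : Q),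
    fun q => hP _ (hpP q) _, fun q _ => (decompose A (p.coeff q) _).2, ?_⟩
  have hpow : ∀ q : ℕ, a ^ q ∈ A (q * i) := fun q => by
    simpa using SetLike.pow_mem_graded q ha
  rw [Polynomial.eval_eq_sum_range, Finset.sum_range_succ, ← hn, hp.coeff_natDegree, one_mul,
    add_comm] at h0
  have h1 := congrArg (GradedRing.proj A (n * i)) h0
  simp only [map_add, map_sum, map_zero, GradedRing.proj_apply,
    decompose_of_mem_same A (hpow n)] at h1
  rw [← h1]
  congr 1
  refine Finset.sum_congr rfl fun q _ => ?_
  rw [← coe_decompose_mul_add_of_right_mem A (hpow q),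
    sub_mul, sub_add_cancel]

/-- An additive action preserving the graded pieces commutes with taking components. -/
theorem decompose_smul_of_smul_mem {G : Type*} [Group G] [MulSemiringAction G Q] {g : G}
    (hg : ∀ i, ∀ a ∈ A i, g • a ∈ A i) (x : Q) (i : ℤ) :
    (decompose A (g • x) i : Q) = g • (decompose A x i : Q) := by
  induction x using DirectSum.Decomposition.inductionOn A with
  | zero => simp
  | @homogeneous j m =>
    by_cases hji : j = i
    · subst hji
      rw [decompose_of_mem_same A (hg j _ m.2), decompose_of_mem_same A m.2]
    · rw [decompose_of_mem_ne A (hg j _ m.2) hji, decompose_of_mem_ne A m.2 hji, smul_zero]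
  | add x y hx hy => simp [decompose_add, hx, hy]

end

/-- Let `Q` be a `ℤ`-graded integral domain, `G` a finite group acting on `Q` by ring
automorphisms with fixed subring `P = Q^G`, such that `Q` is integral over `P` and the grading
of `Q` extends a grading of `P` (i.e. `P` is a graded subring: the homogeneous components of
every element of `P` lie in `P`).  Let `𝔮` be a prime ideal of `Q` and
`𝔮̃ = ⊕_i (𝔮 ∩ Q_i)` the largest homogeneous ideal of `Q` contained in `𝔮` (characterized by:
`x ∈ 𝔮̃` iff every homogeneous component of `x` lies in `𝔮`).  If `D₁, I₁` (resp. `D₂, I₂`)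
denote the decomposition and inertia groups of `𝔮` (resp. of `𝔮̃`), then `D₁ ⊆ D₂` and
`I₁ = I₂`. -/
theorem stmt_14 {Q : Type*} [CommRing Q] [IsDomain Q]
    (QGr : ℤ → AddSubgroup Q) [GradedRing QGr]
    {G : Type*} [Group G] [Finite G] [MulSemiringAction G Q]
    (P : Subring Q) (hP : ∀ x : Q, x ∈ P ↔ ∀ g : G, g • x = x)
    (hint : ∀ x : Q, ∃ p : Polynomial Q,
      p.Monic ∧ (∀ n : ℕ, p.coeff n ∈ P) ∧ Polynomial.eval x p = 0)
    (hgrP : ∀ x ∈ P, ∀ i : ℤ, (DirectSum.decompose QGr x i : Q) ∈ P)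
    (𝔮 : Ideal Q) (h𝔮 : 𝔮.IsPrime)
    (𝔮t : Ideal Q)
    (h𝔮t : ∀ x : Q, x ∈ 𝔮t ↔ ∀ i : ℤ, (DirectSum.decompose QGr x i : Q) ∈ 𝔮)
    (D₁ D₂ I₁ I₂ : Subgroup G)
    (hD₁ : ∀ g : G, g ∈ D₁ ↔ 𝔮.comap (MulSemiringAction.toRingHom G Q g) = 𝔮)
    (hD₂ : ∀ g : G, g ∈ D₂ ↔ 𝔮t.comap (MulSemiringAction.toRingHom G Q g) = 𝔮t)
    (hI₁ : ∀ g : G, g ∈ I₁ ↔ ∀ x : Q, g • x - x ∈ 𝔮)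
    (hI₂ : ∀ g : G, g ∈ I₂ ↔ ∀ x : Q, g • x - x ∈ 𝔮t) :
    D₁ ≤ D₂ ∧ I₁ = I₂ := by
  have hmem : ∀ (g : G) (i : ℤ), ∀ a ∈ QGr i, g • a ∈ QGr i := by
    intro g i a ha
    obtain ⟨p, hp, hpP, h0⟩ := hint a
    obtain ⟨n, c, hcP, hc, hrel⟩ := exists_homogeneous_monic_relation hgrP ha hp hpP h0
    refine mem_of_homogeneous_monic_relation hc ?_
    have h1 := congrArg (fun x => g • x) hrel
    simpa [smul_add, Finset.smul_sum, smul_mul', smul_pow', fun q => (hP _).1 (hcP q) g] using h1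
  have hdec := fun g : G => decompose_smul_of_smul_mem (hmem g)
  refine ⟨fun g hg => ?_, le_antisymm (fun g hg => ?_) (fun g hg => ?_)⟩
  · rw [hD₁] at hg
    have hg' : ∀ x : Q, g • x ∈ 𝔮 ↔ x ∈ 𝔮 := fun x => SetLike.ext_iff.1 hg x
    rw [hD₂]
    ext x
    change g • x ∈ 𝔮t ↔ x ∈ 𝔮t
    simp only [h𝔮t, hdec, hg']
  · rw [hI₁] at hg
    rw [hI₂]
    intro x
    rw [h𝔮t]
    intro i
    simpa [DirectSum.decompose_sub, hdec] using hg (DirectSum.decompose QGr x i : Q)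
  · rw [hI₂] at hg
    rw [hI₁]
    intro x
    classical
    rw [← DirectSum.sum_support_decompose QGr (g • x - x)]
    exact sum_mem fun i _ => (h𝔮t _).1 (hg x) i
end

section
/- For every equivalence class I ⊆ {1,…,d} of the relation ∼, the idempotent Σ_{i∈I} e_i of O^d belongs to A. -/
set_option maxHeartbeats 1000000
set_option synthInstance.maxHeartbeats 1000000

/-- If some element of a subalgebra of a power takes values at `i` and `j` differing by a unit,
then some element takes the values `1` at `i` and `0` at `j`. -/
theorem Subalgebra.exists_eq_one_eq_zero_of_isUnit_sub {R ι : Type*} [CommRing R]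
    (A : Subalgebra R (ι → R)) {a : ι → R} (ha : a ∈ A) {i j : ι} (h : IsUnit (a i - a j)) :
    ∃ b ∈ A, b i = 1 ∧ b j = 0 := by
  obtain ⟨u, hu⟩ := h.exists_left_inv
  refine ⟨u • (a - algebraMap R (ι → R) (a j)),
    A.smul_mem (A.sub_mem ha (A.algebraMap_mem _)) _, ?_, ?_⟩ <;>
    simp [hu]

/-- A subalgebra of a finite power contains the indicator of a finite set `s` as soon as it
separates every point of `s` from every point outside `s`. -/
theorem Subalgebra.sum_single_mem_of_separates {R ι : Type*} [CommRing R] [Fintype ι]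
    [DecidableEq ι] (A : Subalgebra R (ι → R)) (s : Finset ι)
    (h : ∀ i ∈ s, ∀ j ∉ s, ∃ b ∈ A, b i = 1 ∧ b j = 0) :
    (∑ i ∈ s, Pi.single i (1 : R)) ∈ A := by
  have hx : ∀ i ∈ s, ∃ x ∈ A, x i = 1 ∧ ∀ j ∉ s, x j = 0 := by
    intro i hi
    choose! b hbA hbi hbj using h i hi
    refine ⟨∏ j ∈ sᶜ, b j, A.prod_mem fun j hj => hbA j (Finset.mem_compl.1 hj), ?_, ?_⟩
    · rw [Finset.prod_apply]
      exact Finset.prod_eq_one fun j hj => hbi j (Finset.mem_compl.1 hj)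
    · intro j hj
      rw [Finset.prod_apply]
      exact Finset.prod_eq_zero (Finset.mem_compl.2 hj) (hbj j hj)
  choose! x hxA hxi hxj using hx
  have key : ∑ i ∈ s, Pi.single i (1 : R) = 1 - ∏ i ∈ s, (1 - x i) := by
    funext j
    simp only [Finset.sum_apply, Finset.sum_pi_single, Pi.sub_apply, Pi.one_apply,
      Finset.prod_apply]
    by_cases hj : j ∈ s
    · rw [if_pos hj, Finset.prod_eq_zero hj (by simp [hxi j hj]), sub_zero]
    · rw [if_neg hj, Finset.prod_eq_one fun i hi => by simp [hxj i hi j hj], sub_self]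
  rw [key]
  exact A.sub_mem A.one_mem (A.prod_mem fun i hi => A.sub_mem A.one_mem (hxA i hi))

/-- Let `O` be a commutative Noetherian local ring with maximal ideal `𝔪`, let `d ≥ 1`, and let
`A` be a sub-`O`-algebra of `O^d`.  Define `i ∼ j` iff `ω_i(a) ≡ ω_j(a) mod 𝔪` for all
`a ∈ A`, where `ω_i` is the `i`-th coordinate.  Then for every equivalence class `I` of `∼`
(here: the class of an arbitrary `i₀`), the idempotent `∑_{i ∈ I} e_i` of `O^d` belongs
to `A`. -/
theorem stmt_15 (O : Type*) [CommRing O] [IsNoetherianRing O] [IsLocalRing O]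
    (d : ℕ) (hd : 1 ≤ d) (A : Subalgebra O (Fin d → O))
    (i₀ : Fin d) (I : Finset (Fin d))
    (hI : ∀ j : Fin d, j ∈ I ↔
      ∀ a : Fin d → O, a ∈ A → a j - a i₀ ∈ IsLocalRing.maximalIdeal O) :
    (∑ i ∈ I, Pi.single i (1 : O)) ∈ A := by
  refine A.sum_single_mem_of_separates I fun i hi j hj => ?_
  rw [hI] at hi hj
  push Not at hj
  obtain ⟨a, ha, hja⟩ := hj
  refine A.exists_eq_one_eq_zero_of_isUnit_sub ha ?_
  by_contra hu
  apply hja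
  have hmem := (IsLocalRing.mem_maximalIdeal _).2 hu
  simpa using Ideal.sub_mem _ (hi a ha) hmem
end

section
/- Let â denote the image of a ∈ A in the k-algebra kA = k ⊗_O A. Then: (a) if e is a primitive idempotent of A, then ê is a primitive idempotent of kA; (b) the map e ↦ ê is a bijection from the set of primitive idempotents of A onto the set of primitive idempotents of kA. -/
set_option maxHeartbeats 1000000
set_option synthInstance.maxHeartbeats 1000000

/-- An idempotent `e` of a commutative ring is primitive if `e ≠ 0` and `e` cannot be written
as the sum of two nonzero orthogonal idempotents. -/
def IsPrimitiveIdempotent {R : Type*} [CommRing R] (e : R) : Prop :=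
  e ≠ 0 ∧ e * e = e ∧
    ∀ f g : R, f * f = f → g * g = g → f * g = 0 → e = f + g → f = 0 ∨ g = 0

open IsLocalRing in
/-- Two idempotents of a local ring that are congruent modulo the maximal ideal are equal. -/
theorem IsLocalRing.idempotent_eq_of_residue_eq {O : Type*} [CommRing O] [IsLocalRing O] {e f : O}
    (he : e * e = e) (hf : f * f = f) (h : residue O e = residue O f) : e = f := by
  have eq_zero_or_one : ∀ a : O, a * a = a → a = 0 ∨ a = 1 := fun a ha => by
    rcases isUnit_or_isUnit_one_sub_self a with hu | hu
    · exact Or.inr (hu.mul_left_cancel (by rw [ha, mul_one]))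
    · exact Or.inl (hu.mul_left_cancel (by rw [sub_mul, ha]; ring))
  rcases eq_zero_or_one e he with rfl | rfl <;> rcases eq_zero_or_one f hf with rfl | rfl <;>
    simp_all

/-- A ring homomorphism that is bijective on idempotents is bijective on primitive idempotents. -/
theorem bijOn_isPrimitiveIdempotent {R S : Type*} [CommRing R] [CommRing S] (φ : R →+* S)
    (inj : ∀ e f : R, e * e = e → f * f = f → φ e = φ f → e = f)
    (surj : ∀ x : S, x * x = x → ∃ e : R, e * e = e ∧ φ e = x) :
    Set.BijOn φ {e | IsPrimitiveIdempotent e} {x | IsPrimitiveIdempotent x} := by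
  have eq_zero : ∀ e : R, e * e = e → φ e = 0 → e = 0 := fun e he h =>
    inj e 0 he (mul_zero 0) (h.trans (map_zero φ).symm)
  refine ⟨?_, fun e he f hf h => inj e f he.2.1 hf.2.1 h, ?_⟩
  · rintro e ⟨he0, he, hprim⟩
    refine ⟨fun h => he0 (eq_zero e he h), by rw [← map_mul, he], ?_⟩
    intro f' g' hf' hg' hfg' hsum
    obtain ⟨f, hf, rfl⟩ := surj f' hf'
    obtain ⟨g, hg, rfl⟩ := surj g' hg'
    have hfg : f * g = 0 :=
      eq_zero _ (by linear_combination g * g * hf + f * hg) (by rw [map_mul, hfg'])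
    have hadd : e = f + g :=
      inj _ _ he (by linear_combination hf + hg + 2 * hfg) (by rw [map_add, hsum])
    rcases hprim f g hf hg hfg hadd with rfl | rfl
    · exact Or.inl (map_zero φ)
    · exact Or.inr (map_zero φ)
  · rintro x ⟨hx0, hx, hprim⟩
    obtain ⟨e, he, rfl⟩ := surj x hx
    refine ⟨e, ⟨?_, he, ?_⟩, rfl⟩
    · rintro rfl
      exact hx0 (map_zero φ)
    · intro f g hf hg hfg hsum
      refine (hprim (φ f) (φ g) ?_ ?_ ?_ ?_).imp (eq_zero f hf) (eq_zero g hg)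
      · rw [← map_mul, hf]
      · rw [← map_mul, hg]
      · rw [← map_mul, hfg, map_zero]
      · rw [hsum, map_add]

namespace Subalgebra

open IsLocalRing

variable {O ι : Type*} [CommRing O] (A : Subalgebra O (ι → O))

theorem isUnit_of_forall_isUnit_apply [Finite ι] (u : A) (h : ∀ i, IsUnit (u.1 i)) : IsUnit u := by
  have h_int : A.val.toRingHom.IsIntegral :=
    RingHom.IsIntegral.tower_top (algebraMap O A) A.val.toRingHom
      (algebraMap_isIntegral_iff.mpr (inferInstanceAs (Algebra.IsIntegral O (ι → O))))
  have := h_int.isLocalHom Subtype.val_injective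
  exact isUnit_of_map_unit A.val.toRingHom u (Pi.isUnit_iff.mpr h)

variable [IsLocalRing O]

/-- The character of `k ⊗ A` induced by the `i`-th coordinate. -/
noncomputable def residueCoord (i : ι) :
    TensorProduct O (O ⧸ maximalIdeal O) A →ₐ[O] (O ⧸ maximalIdeal O) :=
  Algebra.TensorProduct.lift (AlgHom.id O _)
    ((Ideal.Quotient.mkₐ O (maximalIdeal O)).comp ((Pi.evalAlgHom O (fun _ : ι => O) i).comp A.val))
    fun _ _ => Commute.all _ _

theorem residueCoord_includeRight (i : ι) (a : A) :
    A.residueCoord i (Algebra.TensorProduct.includeRight a) = residue O (a.1 i) := by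
  simp [residueCoord]
  rfl

theorem residue_apply_eq_of_includeRight_eq {a b : A}
    (h : (Algebra.TensorProduct.includeRight a : TensorProduct O (O ⧸ maximalIdeal O) A) =
      Algebra.TensorProduct.includeRight b) (i : ι) : residue O (a.1 i) = residue O (b.1 i) := by
  rw [← residueCoord_includeRight, h, residueCoord_includeRight]

theorem idempotent_eq_of_includeRight_eq {e f : A} (he : e * e = e) (hf : f * f = f)
    (h : (Algebra.TensorProduct.includeRight e : TensorProduct O (O ⧸ maximalIdeal O) A) =
      Algebra.TensorProduct.includeRight f) : e = f := by
  ext i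
  exact idempotent_eq_of_residue_eq (congrFun (congrArg Subtype.val he) i)
    (congrFun (congrArg Subtype.val hf) i) (A.residue_apply_eq_of_includeRight_eq h i)

/-- If `x` is the image of `a`, split `∏ i, (X - ω i a)` into the factors with `ω i a ∈ 𝔪` and
those with `ω i a ∈ 1 + 𝔪`. Evaluated at `a` these give `p` and `q` with `p * q = 0`, mapping to
`x` and `1 - x`, so that `p + q` is a unit and `p / (p + q)` is an idempotent lifting `x`. -/
theorem exists_idempotent_includeRight_eq [Finite ι]
    (x : TensorProduct O (O ⧸ maximalIdeal O) A) (hx : x * x = x) :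
    ∃ e : A, e * e = e ∧ Algebra.TensorProduct.includeRight e = x := by
  classical
  cases nonempty_fintype ι
  obtain ⟨a, rfl⟩ := Algebra.TensorProduct.includeRight_surjective A
    (Ideal.Quotient.mk_surjective (I := maximalIdeal O)) x
  set φ := (Algebra.TensorProduct.includeRight :
    A →ₐ[O] TensorProduct O (O ⧸ maximalIdeal O) A)
  have map_algebraMap_eq_zero : ∀ r : O, residue O r = 0 → φ (algebraMap O A r) = 0 := by
    intro r hr
    rw [AlgHom.commutes, IsScalarTower.algebraMap_apply O (O ⧸ maximalIdeal O),
      show algebraMap O (O ⧸ maximalIdeal O) r = 0 from hr, map_zero]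
  have residue_eq : ∀ i, residue O (a.1 i) = 0 ∨ residue O (a.1 i) = 1 := by
    intro i
    have h := A.residue_apply_eq_of_includeRight_eq (a := a * a) ((map_mul φ a a).trans hx) i
    exact IsIdempotentElem.iff_eq_zero_or_one.mp ((map_mul (residue O) _ _).symm.trans h)
  let p : A := a * ∏ i with residue O (a.1 i) = 0, (a - algebraMap O A (a.1 i))
  let q : A := (1 - a) * ∏ i with ¬ residue O (a.1 i) = 0, (algebraMap O A (a.1 i) - a)
  have hpq : p * q = 0 := by
    ext i
    by_cases hi : residue O (a.1 i) = 0
    · have : p.1 i = 0 := by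
        simp only [p, MulMemClass.coe_mul, Pi.mul_apply, SubmonoidClass.coe_finsetProd,
          Finset.prod_apply]
        rw [Finset.prod_eq_zero (i := i) (by simpa using hi) (by simp), mul_zero]
      simp [this]
    · have : q.1 i = 0 := by
        simp only [q, MulMemClass.coe_mul, Pi.mul_apply, SubmonoidClass.coe_finsetProd,
          Finset.prod_apply]
        rw [Finset.prod_eq_zero (i := i) (by simpa using hi) (by simp), mul_zero]
      simp [this]
  have hp : φ p = φ a := by
    have : ∀ i ∈ Finset.univ.filter fun i => residue O (a.1 i) = 0,
        φ (a - algebraMap O A (a.1 i)) = φ a := fun i hi => by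
      rw [map_sub, map_algebraMap_eq_zero _ (Finset.mem_filter.mp hi).2, sub_zero]
    rw [map_mul, map_prod, Finset.prod_congr rfl this, Finset.prod_const, ← pow_succ']
    exact IsIdempotentElem.pow_succ_eq _ hx
  have hq : φ q = 1 - φ a := by
    have : ∀ i ∈ Finset.univ.filter fun i => ¬ residue O (a.1 i) = 0,
        φ (algebraMap O A (a.1 i) - a) = 1 - φ a := fun i hi => by
      have h1 := (residue_eq i).resolve_left (Finset.mem_filter.mp hi).2
      have h0 := map_algebraMap_eq_zero (a.1 i - 1) (by rw [map_sub, h1, map_one, sub_self])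
      rw [map_sub, map_one, map_sub, map_one] at h0
      rw [map_sub, sub_eq_zero.mp h0]
    rw [map_mul, map_prod, Finset.prod_congr rfl this, Finset.prod_const, map_sub, map_one,
      ← pow_succ']
    exact IsIdempotentElem.pow_succ_eq _ (IsIdempotentElem.one_sub hx)
  have hφu : φ (p + q) = 1 := by rw [map_add, hp, hq, add_sub_cancel]
  obtain ⟨v, hv⟩ := (A.isUnit_of_forall_isUnit_apply (p + q) fun i => by
    rw [← residue_ne_zero_iff_isUnit,
      A.residue_apply_eq_of_includeRight_eq (hφu.trans (map_one φ).symm) i]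
    simp).exists_right_inv
  refine ⟨p * v, by linear_combination (p * v) * hv - v * v * hpq, ?_⟩
  have hφv : φ v = 1 := by simpa [hφu] using congrArg φ hv
  rw [map_mul, hp, hφv, mul_one]

end Subalgebra

/-- Let `O` be a commutative Noetherian local ring with maximal ideal `𝔪` and residue field
`k = O/𝔪`, let `d ≥ 1`, let `A` be a sub-`O`-algebra of `O^d`, and let `â = 1 ⊗ a` denote the
image of `a ∈ A` in `kA = k ⊗_O A`.  Then (a) if `e` is a primitive idempotent of `A`, then
`ê` is a primitive idempotent of `kA`; and (b) `e ↦ ê` is a bijection from the set of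
primitive idempotents of `A` onto the set of primitive idempotents of `kA`. -/
theorem stmt_16 (O : Type*) [CommRing O] [IsNoetherianRing O] [IsLocalRing O]
    (d : ℕ) (hd : 1 ≤ d) (A : Subalgebra O (Fin d → O)) :
    (∀ e : ↥A, IsPrimitiveIdempotent e →
      IsPrimitiveIdempotent
        ((Algebra.TensorProduct.includeRight :
          ↥A →ₐ[O] TensorProduct O (O ⧸ IsLocalRing.maximalIdeal O) ↥A) e)) ∧
      Set.BijOn
        (fun e : ↥A =>
          (Algebra.TensorProduct.includeRight :
            ↥A →ₐ[O] TensorProduct O (O ⧸ IsLocalRing.maximalIdeal O) ↥A) e)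
        {e : ↥A | IsPrimitiveIdempotent e}
        {x : TensorProduct O (O ⧸ IsLocalRing.maximalIdeal O) ↥A |
          IsPrimitiveIdempotent x} := by
  have h := bijOn_isPrimitiveIdempotent
    (Algebra.TensorProduct.includeRight :
      ↥A →ₐ[O] TensorProduct O (O ⧸ IsLocalRing.maximalIdeal O) ↥A).toRingHom
    (fun _ _ he hf => A.idempotent_eq_of_includeRight_eq he hf)
    A.exists_idempotent_includeRight_eq
  exact ⟨fun e he => h.mapsTo he, h⟩
end

section
/- Let x ∈ K with x ∉ R (i.e., x is not in the image of R in K), and let 𝔞_x = {r ∈ R | r·x ∈ R}, which is an ideal of R. Then every prime ideal of R that is minimal among the prime ideals containing 𝔞_x has height 1. -/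
set_option maxHeartbeats 1000000
set_option synthInstance.maxHeartbeats 1000000

section

variable {R K : Type*} [CommRing R] [IsDomain R] [Field K] [Algebra R K] [IsFractionRing R K]

theorem Ideal.ne_bot_of_eq_colon_one_singleton {p : Ideal R} {y : K}
    (hp : p = (1 : Submodule R K).colon {y}) : p ≠ ⊥ := by
  obtain ⟨⟨b, c⟩, hbc⟩ := IsLocalization.surj (nonZeroDivisors R) y
  refine (Submodule.ne_bot_iff _).mpr ⟨c, ?_, nonZeroDivisors.ne_zero c.2⟩
  rw [hp, Submodule.mem_colon_singleton, Submodule.mem_one]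
  exact ⟨b, by rw [Algebra.smul_def, mul_comm, hbc]⟩

/-- In a Noetherian integrally closed domain, a prime ideal that is the ideal of denominators of an
element of the fraction field has height at most one. -/
theorem Ideal.height_le_one_of_eq_colon_one_singleton [IsNoetherianRing R] [IsIntegrallyClosed R]
    {p : Ideal R} [p.IsPrime] {y : K} (hp : p = (1 : Submodule R K).colon {y}) :
    p.height ≤ 1 := by
  have mem_p (r : R) : r ∈ p ↔ ∃ v, algebraMap R K v = algebraMap R K r * y := by
    rw [hp, Submodule.mem_colon_singleton, Submodule.mem_one, Algebra.smul_def]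
  by_cases hstable : ∀ r ∈ p, ∀ v, algebraMap R K v = algebraMap R K r * y → v ∈ p
  · have hint : IsIntegral R y := by
      refine isIntegral_of_smul_mem_submodule (Submodule.map (Algebra.linearMap R K) p) ?_
        ((IsNoetherian.noetherian p).map _) y ?_
      · obtain ⟨r, hr, hr0⟩ :=
          (Submodule.ne_bot_iff p).mp (ne_bot_of_eq_colon_one_singleton hp)
        exact (Submodule.ne_bot_iff _).mpr ⟨algebraMap R K r, ⟨r, hr, rfl⟩,
          (map_ne_zero_iff _ (IsFractionRing.injective R K)).mpr hr0⟩
      · rintro _ ⟨r, hr, rfl⟩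
        obtain ⟨v, hv⟩ := (mem_p r).mp hr
        exact ⟨v, hstable r hr v hv, by simp [hv, mul_comm]⟩
    obtain ⟨z, hz⟩ := IsIntegrallyClosed.algebraMap_eq_of_integral hint
    exact absurd ((Ideal.eq_top_iff_one p).mpr ((mem_p 1).mpr ⟨z, by simp [hz]⟩))
      (IsPrime.ne_top ‹_›)
  · push Not at hstable
    obtain ⟨t, ht, u, hu, hup⟩ := hstable
    refine height_le_one_of_isPrincipal_of_mem_minimalPrimes (span {t}) p
      ⟨⟨‹_›, (span_singleton_le_iff_mem p).mpr ht⟩, fun q ⟨hq, htq⟩ hqp r hr ↦ ?_⟩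
    obtain ⟨v, hv⟩ := (mem_p r).mp hr
    have hruv : r * u = t * v := by
      apply IsFractionRing.injective R K
      rw [map_mul, map_mul, hu, hv]
      ring
    have hmem : r * u ∈ q :=
      hruv ▸ q.mul_mem_right v ((span_singleton_le_iff_mem q).mp htq)
    exact (hq.mem_or_mem hmem).resolve_right fun h ↦ hup (hqp h)

end

/-- Let `R` be a Noetherian integrally closed integral domain with field of fractions `K`.
Let `x ∈ K` with `x ∉ R`, and let `𝔞_x = {r ∈ R | r·x ∈ R}` (an ideal of `R`).  Then every
prime ideal of `R` minimal among the primes containing `𝔞_x` has height `1` (expressed below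
as: it is nonzero and every prime strictly contained in it is zero). -/
theorem stmt_17 (R : Type*) [CommRing R] [IsDomain R] [IsNoetherianRing R]
    [IsIntegrallyClosed R]
    (K : Type*) [Field K] [Algebra R K] [IsFractionRing R K]
    (x : K) (hx : x ∉ Set.range (algebraMap R K))
    (a : Ideal R)
    (ha : ∀ r : R, r ∈ a ↔ algebraMap R K r * x ∈ Set.range (algebraMap R K))
    (𝔭 : Ideal R) (h1 : 𝔭.IsPrime) (h2 : a ≤ 𝔭)
    (h3 : ∀ 𝔮 : Ideal R, 𝔮.IsPrime → a ≤ 𝔮 → 𝔮 ≤ 𝔭 → 𝔮 = 𝔭) :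
    𝔭 ≠ ⊥ ∧ ∀ 𝔮 : Ideal R, 𝔮.IsPrime → 𝔮 < 𝔭 → 𝔮 = ⊥ := by
  have hcolon : a = (1 : Submodule R K).colon {x} := by
    ext r
    rw [ha, Submodule.mem_colon_singleton, Submodule.mem_one, Algebra.smul_def, Set.mem_range]
  have hmin : 𝔭 ∈ ((1 : Submodule R K).colon {x}).minimalPrimes :=
    hcolon ▸ ⟨⟨h1, h2⟩, fun 𝔮 h𝔮 hle ↦ (h3 𝔮 h𝔮.1 h𝔮.2 hle).ge⟩
  obtain ⟨y, hy⟩ := Submodule.exists_eq_colon_of_mem_minimalPrimes hmin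
  refine ⟨Ideal.ne_bot_of_eq_colon_one_singleton hy, fun 𝔮 h𝔮 hlt ↦ ?_⟩
  rw [← Ideal.height_eq_zero_iff_eq_bot, ← Order.lt_one_iff]
  exact (Ideal.height_strict_mono_of_isPrime_of_isPrime hlt).trans_le
    (Ideal.height_le_one_of_eq_colon_one_singleton hy)
end

section
/- The ring O[q^ℝ] is an integral domain and is integrally closed in its field of fractions. -/
set_option maxHeartbeats 1000000
set_option synthInstance.maxHeartbeats 1000000

open AddMonoidAlgebra in
/-- Elements of a group algebra supported in a subgroup `H` come from the group algebra of `H`. -/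
theorem AddMonoidAlgebra.mem_range_mapDomainRingHom_subtype {R G : Type*} [CommRing R]
    [AddCommGroup G] {H : AddSubgroup G} {x : AddMonoidAlgebra R G}
    (hx : (x.coeff.support : Set G) ⊆ H) :
    x ∈ (mapDomainRingHom R H.subtype).range :=
  ⟨comapDomain H.subtype H.subtype_injective x,
    mapDomain_comapDomain (by simpa using hx) H.subtype_injective⟩

/-- If `A` is integrally closed and embeds in a field `K`, then every quotient of elements of `A`
which is integral over `A` lies in `A`. -/
theorem IsIntegrallyClosed.exists_eq_of_isIntegralElem_of_mul_eq {A K : Type*} [CommRing A]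
    [IsDomain A] [IsIntegrallyClosed A] [Field K] {f : A →+* K} (hf : Function.Injective f)
    {a b : A} (hb : b ≠ 0) {x : K} (hx : f.IsIntegralElem x) (hab : x * f b = f a) :
    ∃ c, f c = x := by
  algebraize [f]
  have : FaithfulSMul A K := (faithfulSMul_iff_algebraMap_injective A K).mpr hf
  let g : FractionRing A →ₐ[A] K := IsFractionRing.liftAlgHom (g := Algebra.ofId A K) hf
  have hg : g (algebraMap A _ a / algebraMap A _ b) = x := by
    have hb' : f b ≠ 0 := (map_ne_zero_iff f hf).mpr hb
    rw [map_div₀, g.commutes, g.commutes]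
    exact (div_eq_iff hb').mpr hab.symm
  have hint : IsIntegral A (algebraMap A (FractionRing A) a / algebraMap A _ b) :=
    (isIntegral_algHom_iff g g.toRingHom.injective).mp (hg ▸ hx)
  obtain ⟨c, hc⟩ := (isIntegrallyClosed_iff (FractionRing A)).mp ‹_› hint
  exact ⟨c, by rw [← hg, ← hc, g.commutes]; rfl⟩

theorem LaurentPolynomial.isIntegrallyClosed {R : Type*} [CommRing R] [IsDomain R]
    [IsIntegrallyClosed R] : IsIntegrallyClosed (LaurentPolynomial R) :=
  isIntegrallyClosed_of_isLocalization _ (Submonoid.powers (Polynomial.X : Polynomial R))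
    (powers_le_nonZeroDivisors_of_noZeroDivisors Polynomial.X_ne_zero)

namespace AddMonoidAlgebra

variable {R : Type*} [CommRing R] [IsDomain R] [IsIntegrallyClosed R]

theorem isIntegrallyClosed_fin_int (n : ℕ) :
    IsIntegrallyClosed (AddMonoidAlgebra R (Fin n → ℤ)) := by
  induction n with
  | zero => exact .of_equiv (uniqueRingEquiv (R := R) (Fin 0 → ℤ)).symm
  | succ n ih =>
    have := LaurentPolynomial.isIntegrallyClosed (R := AddMonoidAlgebra R (Fin n → ℤ))
    have h : IsIntegrallyClosed (AddMonoidAlgebra R (ℤ × (Fin n → ℤ))) :=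
      .of_equiv (R := LaurentPolynomial (AddMonoidAlgebra R (Fin n → ℤ)))
        (curryRingEquiv (R := R) (M := ℤ) (N := Fin n → ℤ)).symm
    exact .of_equiv (mapDomainRingEquiv R (Fin.consLinearEquiv ℤ fun _ ↦ ℤ).toAddEquiv)

theorem isIntegrallyClosed_of_fg {G : Type*} [AddCommGroup G] [IsAddTorsionFree G]
    [AddGroup.FG G] : IsIntegrallyClosed (AddMonoidAlgebra R G) := by
  have : Module.Finite ℤ G := Module.Finite.iff_addGroup_fg.mpr ‹_›
  have := isIntegrallyClosed_fin_int (R := R) (Module.finrank ℤ G)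
  exact .of_equiv (mapDomainRingEquiv R (Module.finBasis ℤ G).equivFun.symm.toAddEquiv)

theorem isIntegrallyClosed {G : Type*} [AddCommGroup G] [IsAddTorsionFree G]
    [IsDomain (AddMonoidAlgebra R G)] : IsIntegrallyClosed (AddMonoidAlgebra R G) := by
  classical
  let K := FractionRing (AddMonoidAlgebra R G)
  refine (isIntegrallyClosed_iff K).mpr fun {x} ⟨p, hp, hpx⟩ ↦ ?_
  obtain ⟨a, b, hb, rfl⟩ := IsFractionRing.div_surjective (A := AddMonoidAlgebra R G) x
  have hb0 : b ≠ 0 := nonZeroDivisors.ne_zero hb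
  let S : Finset (AddMonoidAlgebra R G) := insert a (insert b p.coeffs)
  let H : AddSubgroup G := AddSubgroup.closure (S.biUnion fun y ↦ y.coeff.support)
  have hS (y) (hy : y ∈ S) : y ∈ (mapDomainRingHom R H.subtype).range := by
    refine mem_range_mapDomainRingHom_subtype (.trans ?_ AddSubgroup.subset_closure)
    exact_mod_cast Finset.subset_biUnion_of_mem (fun y ↦ y.coeff.support) hy
  have : AddGroup.FG H := AddGroup.closure_finset_fg _
  have : IsIntegrallyClosed (AddMonoidAlgebra R H) := isIntegrallyClosed_of_fg
  have hinj : Function.Injective (mapDomainRingHom R H.subtype) :=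
    mapDomain_injective H.subtype_injective
  have : IsDomain (AddMonoidAlgebra R H) := hinj.isDomain
  obtain ⟨a', ha⟩ := hS a (by simp [S])
  obtain ⟨b', hb'⟩ := hS b (by simp [S])
  have hpl : p ∈ Polynomial.lifts (mapDomainRingHom R H.subtype) := by
    rw [Polynomial.lifts_iff_coeff_lifts]
    intro n
    by_cases hn : p.coeff n = 0
    · exact ⟨0, by simp [hn]⟩
    · exact hS _ (by simp [S, Polynomial.coeff_mem_coeffs hn])
  obtain ⟨q, hqp, -, hq⟩ := Polynomial.lifts_and_natDegree_eq_and_monic hpl hp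
  obtain ⟨c, hc⟩ := IsIntegrallyClosed.exists_eq_of_isIntegralElem_of_mul_eq
    (f := (algebraMap (AddMonoidAlgebra R G) K).comp (mapDomainRingHom R H.subtype))
    ((IsFractionRing.injective _ K).comp hinj) (a := a') (b := b')
    (ne_zero_of_map (hb'.trans_ne hb0)) ⟨q, hq, by rwa [← hqp, Polynomial.eval₂_map] at hpx⟩
    (by
      rw [RingHom.comp_apply, RingHom.comp_apply, ha, hb']
      exact div_mul_cancel₀ _ ((map_ne_zero_iff _ (IsFractionRing.injective _ K)).mpr hb0))
  exact ⟨_, hc⟩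

end AddMonoidAlgebra

/-- Let `F` be a number field and `O` its ring of integers.  The group algebra `O[q^ℝ]` of the
additive group `(ℝ, +)` over `O` (the free `O`-module with basis `(q^r)_{r ∈ ℝ}` and
multiplication `q^r·q^{r'} = q^{r+r'}`, i.e. `AddMonoidAlgebra O ℝ`) is an integral domain and
is integrally closed in its field of fractions. -/
theorem stmt_18 (F : Type*) [Field F] [NumberField F] :
    IsDomain (AddMonoidAlgebra (NumberField.RingOfIntegers F) ℝ) ∧
      IsIntegrallyClosed (AddMonoidAlgebra (NumberField.RingOfIntegers F) ℝ) := by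
  have : IsDomain (AddMonoidAlgebra (NumberField.RingOfIntegers F) ℝ) :=
    NoZeroDivisors.to_isDomain _
  exact ⟨this, AddMonoidAlgebra.isIntegrallyClosed⟩
end

section
/- Let K be a field, f ∈ K[t] a polynomial, and K(Y) the field of rational functions in one indeterminate Y over K. Then the Galois group of f over K(Y) (the Galois group of a splitting field over K(Y) of the image of f in K(Y)[t]) is isomorphic to the Galois group of f over K. -/
set_option maxHeartbeats 1000000
set_option synthInstance.maxHeartbeats 1000000

open Polynomial

section Compositum

variable {K F L M : Type*} [Field K] [Field F] [Field L] [Field M]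
  [Algebra K F] [Algebra K L] [Algebra K M] [Algebra F M] [Algebra L M]
  [IsScalarTower K F M] [IsScalarTower K L M]

/-- If `L` is a splitting field of `f` over `K`, and `M` is generated by `L` as a field over
`F ⊇ K`, then `M` is a splitting field of `f` over `F`. -/
theorem Polynomial.IsSplittingField.map_of_adjoin_range_eq_top (f : K[X])
    [f.IsSplittingField K L]
    (h : IntermediateField.adjoin F (Set.range (algebraMap L M)) = ⊤) :
    (f.map (algebraMap K F)).IsSplittingField F M := by
  have hM : (f.map (algebraMap K F)).map (algebraMap F M) =
      (f.map (algebraMap K L)).map (algebraMap L M) := by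
    simp only [Polynomial.map_map, ← IsScalarTower.algebraMap_eq]
  rw [isSplittingField_iff_intermediateField]
  refine ⟨hM ▸ (IsSplittingField.splits L f).map _, ?_⟩
  rw [eq_top_iff, ← h, IntermediateField.adjoin_le_iff]
  set N := IntermediateField.adjoin F ((f.map (algebraMap K F)).rootSet M)
  have hle : (⊤ : Subalgebra K L) ≤
      (N.restrictScalars K).toSubalgebra.comap (IsScalarTower.toAlgHom K L M) := by
    rw [← IsSplittingField.adjoin_rootSet L f, Algebra.adjoin_le_iff]
    intro x hx
    refine IntermediateField.subset_adjoin F _ ?_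
    have hx' := mem_rootSet'.mp hx
    rw [mem_rootSet', hM]
    refine ⟨(Polynomial.map_ne_zero_iff (algebraMap L M).injective).mpr hx'.1, ?_⟩
    simp [aeval_map_algebraMap, aeval_algebraMap_apply, hx'.2]
  rintro _ ⟨x, rfl⟩
  exact hle (Algebra.mem_top (x := x))

/-- If `L / K` is normal, `M / F` is algebraic and generated by `L`, and every `K`-automorphism of
`L` extends to an `F`-endomorphism of `M`, then restriction to `L` identifies `Gal(M/F)` with
`Gal(L/K)`. -/
theorem AlgEquiv.nonempty_mulEquiv_of_adjoin_range_eq_top [Normal K L] [Algebra.IsAlgebraic F M]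
    (h : IntermediateField.adjoin F (Set.range (algebraMap L M)) = ⊤)
    (hext : ∀ σ : L ≃ₐ[K] L, ∃ τ : M →ₐ[F] M, ∀ x, τ (algebraMap L M x) = algebraMap L M (σ x)) :
    Nonempty ((M ≃ₐ[F] M) ≃* (L ≃ₐ[K] L)) := by
  let r : (M ≃ₐ[F] M) →* (L ≃ₐ[K] L) :=
    (AlgEquiv.restrictNormalHom L).comp
      { toFun := fun τ => τ.restrictScalars K
        map_one' := rfl
        map_mul' := fun _ _ => rfl }
  have hr (τ : M ≃ₐ[F] M) (x : L) : algebraMap L M (r τ x) = τ (algebraMap L M x) :=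
    AlgEquiv.restrictNormal_commutes (τ.restrictScalars K) L x
  refine ⟨MulEquiv.ofBijective r ⟨fun τ₁ τ₂ hτ => ?_, fun σ => ?_⟩⟩
  · ext x
    have hx : x ∈ IntermediateField.adjoin F (Set.range (algebraMap L M)) := by simp [h]
    induction hx using IntermediateField.adjoin_induction with
    | mem _ hy =>
      obtain ⟨y, rfl⟩ := hy
      rw [← hr, ← hr, hτ]
    | algebraMap y => simp
    | add _ _ _ _ hy hz => simp [hy, hz]
    | inv _ _ hy => simp [hy]
    | mul _ _ _ _ hy hz => simp [hy, hz]
  · obtain ⟨τ, hτ⟩ := hext σ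
    refine ⟨AlgEquiv.ofBijective τ (Algebra.IsAlgebraic.algHom_bijective τ), ?_⟩
    ext x
    apply (algebraMap L M).injective
    rw [hr]
    exact hτ x

end Compositum

namespace RatFunc

variable {A B : Type*} [Field A] [Field B]

/-- The homomorphism `A(Y) → B(Y)` induced by a homomorphism of fields `A → B`. -/
noncomputable def mapCoeff (φ : A →+* B) : RatFunc A →+* RatFunc B :=
  RatFunc.mapRingHom (Polynomial.mapRingHom φ)
    (nonZeroDivisors_le_comap_nonZeroDivisors_of_injective _ (Polynomial.map_injective φ φ.injective))

theorem mapCoeff_algebraMap_polynomial (φ : A →+* B) (p : A[X]) :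
    mapCoeff φ (algebraMap A[X] (RatFunc A) p) = algebraMap B[X] (RatFunc B) (p.map φ) := by
  have h := RatFunc.map_apply_div (Polynomial.mapRingHom φ)
    (nonZeroDivisors_le_comap_nonZeroDivisors_of_injective _
      (Polynomial.map_injective φ φ.injective)) p 1
  simpa [mapCoeff, RatFunc.coe_mapRingHom_eq_coe_map] using h

theorem mapCoeff_algebraMap (φ : A →+* B) (a : A) :
    mapCoeff φ (algebraMap A (RatFunc A) a) = algebraMap B (RatFunc B) (φ a) := by
  rw [IsScalarTower.algebraMap_apply A A[X] (RatFunc A), mapCoeff_algebraMap_polynomial,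
    IsScalarTower.algebraMap_apply B B[X] (RatFunc B)]
  simp

theorem mapCoeff_X (φ : A →+* B) : mapCoeff φ X = X := by
  rw [← RatFunc.algebraMap_X, mapCoeff_algebraMap_polynomial, Polynomial.map_X,
    RatFunc.algebraMap_X]

theorem mapCoeff_mapCoeff {D : Type*} [Field D] (φ : A →+* B) (ψ : B →+* D) (x : RatFunc A) :
    mapCoeff ψ (mapCoeff φ x) = mapCoeff (ψ.comp φ) x := by
  induction x using RatFunc.induction_on with
  | f p q hq => simp only [map_div₀, mapCoeff_algebraMap_polynomial, Polynomial.map_map]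

/-- A subfield of `A(Y)` containing `A` and `Y` is everything. -/
theorem mem_subfield_of_algebraMap_mem_of_X_mem (S : Subfield (RatFunc A))
    (hA : ∀ a : A, algebraMap A (RatFunc A) a ∈ S) (hX : X ∈ S) (x : RatFunc A) : x ∈ S := by
  have hp (p : A[X]) : algebraMap A[X] (RatFunc A) p ∈ S := by
    induction p using Polynomial.induction_on' with
    | add p q hp hq => rw [map_add]; exact add_mem hp hq
    | monomial n a =>
      rw [← Polynomial.C_mul_X_pow_eq_monomial, map_mul, map_pow, RatFunc.algebraMap_X,
        RatFunc.algebraMap_C]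
      exact mul_mem (hA a) (pow_mem hX n)
  induction x using RatFunc.induction_on with
  | f p q hq => exact div_mem (hp p) (hp q)

end RatFunc

/-- If `L` is a splitting field of `f` over `K`, then the Galois group of `f` over `K(Y)` is
isomorphic to `Gal(L/K)`, since `L(Y)` is a splitting field of `f` over `K(Y)`. -/
theorem Polynomial.Gal.nonempty_map_ratFunc_mulEquiv {K L : Type*} [Field K] [Field L] [Algebra K L]
    (f : K[X]) [f.IsSplittingField K L] :
    Nonempty ((f.map (algebraMap K (RatFunc K))).Gal ≃* (L ≃ₐ[K] L)) := by
  let _ : Algebra (RatFunc K) (RatFunc L) := (RatFunc.mapCoeff (algebraMap K L)).toAlgebra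
  have : IsScalarTower K L (RatFunc L) := IsScalarTower.of_algebraMap_eq fun _ => rfl
  have : IsScalarTower K (RatFunc K) (RatFunc L) := IsScalarTower.of_algebraMap_eq fun a =>
    (RatFunc.mapCoeff_algebraMap (algebraMap K L) a).symm
  have h : IntermediateField.adjoin (RatFunc K) (Set.range (algebraMap L (RatFunc L))) = ⊤ := by
    refine eq_top_iff.mpr fun x _ => ?_
    refine RatFunc.mem_subfield_of_algebraMap_mem_of_X_mem
      (IntermediateField.adjoin (RatFunc K) (Set.range (algebraMap L (RatFunc L)))).toSubfield
      (fun a => IntermediateField.subset_adjoin _ _ (Set.mem_range_self a)) ?_ x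
    rw [← RatFunc.mapCoeff_X (algebraMap K L)]
    exact IntermediateField.algebraMap_mem _ RatFunc.X
  have := IsSplittingField.map_of_adjoin_range_eq_top f h
  have := IsSplittingField.finiteDimensional (RatFunc L) (f.map (algebraMap K (RatFunc K)))
  have : Normal K L := Normal.of_isSplittingField f
  have hext (σ : L ≃ₐ[K] L) : ∃ τ : RatFunc L →ₐ[RatFunc K] RatFunc L, ∀ x,
      τ (algebraMap L (RatFunc L) x) = algebraMap L (RatFunc L) (σ x) :=
    ⟨{ RatFunc.mapCoeff (σ : L →+* L) with
        commutes' := fun x => by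
          refine (RatFunc.mapCoeff_mapCoeff (algebraMap K L) (σ : L →+* L) x).trans ?_
          congr 2
          exact RingHom.ext fun a => σ.commutes a },
      fun x => RatFunc.mapCoeff_algebraMap (σ : L →+* L) x⟩
  obtain ⟨e⟩ := AlgEquiv.nonempty_mulEquiv_of_adjoin_range_eq_top (K := K) (L := L) h hext
  exact ⟨(IsSplittingField.algEquiv (RatFunc L) (f.map _)).symm.autCongr.trans e⟩

/-- Let `K` be a field, `f ∈ K[t]` a polynomial, and `K(Y)` the field of rational functions in
one indeterminate over `K`.  Then the Galois group of `f` over `K(Y)` (the Galois group of a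
splitting field over `K(Y)` of the image of `f` in `K(Y)[t]`) is isomorphic to the Galois
group of `f` over `K`. -/
theorem stmt_19 (K : Type*) [Field K] (f : Polynomial K) :
    Nonempty ((f.map (algebraMap K (RatFunc K))).Gal ≃* f.Gal) :=
  Polynomial.Gal.nonempty_map_ratFunc_mulEquiv f
end
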